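/- arXiv:hep-ph/9801404 — 2 statements merged into one kernel-verified Lean document; each statement's English description precedes it below -/
import Mathlib

section
/- (Wick's theorem for non-symmetric normal ordered products and contractions.) Let {ψᵢ = ψᵢ⁺ + ψᵢ⁻ : i = 1,...,2n} be fields in a ring A with pairwise distinct times, and suppose every commutator [ψᵢ^ε, ψⱼ^δ] with ε, δ ∈ {+,−} lies in the center of A (the contraction is a c-number). Then the time-ordered product of all 2n fields equals the usual Wick sum: T(1, 2, ..., 2n) = Σ_P (∏_{{i,j} ∈ P, i<j} D(i,j)) · N(r₁,...,r_{2n−2|P|}), where the sum runs over all sets P (including the empty set) of pairwise disjoint 2-element subsets of {1,...,2n}, and (r₁,...,r_{2n−2|P|}) is the increasing enumeration of the indices not occurring in any pair of P. The factors D(i,j) are central, so the order of the product over P is immaterial. -/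
/-- The full field: sum of its `+` and `-` parts. -/
def psi {ι A : Type*} [Ring A] (psiP psiM : ι → A) (i : ι) : A := psiP i + psiM i

/-- Two-point normal ordered product `N(i,j)`. -/
def N2 {ι A : Type*} [Ring A] (psiP psiM : ι → A) (i j : ι) : A :=
  psiP i * psiP j + psiM i * psiP j + psiM j * psiP i + psiM i * psiM j

/-- Two-point time-ordered product `T(i,j)` (for distinct times). -/
noncomputable def T2 {ι A : Type*} [Ring A] (psiP psiM : ι → A) (t : ι → ℝ) (i j : ι) : A :=
  if t i > t j then psi psiP psiM i * psi psiP psiM j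
  else psi psiP psiM j * psi psiP psiM i

/-- The contraction `D(i,j) := T(i,j) - N(i,j)`. -/
noncomputable def D2 {ι A : Type*} [Ring A] (psiP psiM : ι → A) (t : ι → ℝ) (i j : ι) : A :=
  T2 psiP psiM t i j - N2 psiP psiM i j

/-- Multi-point normal ordered product of a list of field indices:
`N(i₁,…,iₖ) = Σ_{S ⊆ {1,…,k}} (∏_{j∈S, j increasing} ψ_{i_j}⁻)·(∏_{j∉S, j increasing} ψ_{i_j}⁺)`. -/
def Nord {ι A : Type*} [Ring A] (psiP psiM : ι → A) (L : List ι) : A :=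
  ∑ S : Finset (Fin L.length),
    (((List.finRange L.length).filter (fun j => decide (j ∈ S))).map
        (fun j => psiM (L.get j))).prod *
    (((List.finRange L.length).filter (fun j => decide (j ∉ S))).map
        (fun j => psiP (L.get j))).prod

/-- Multi-point time ordered product: the fields multiplied in order of decreasing time. -/
noncomputable def Tlist {ι A : Type*} [Ring A] (psiP psiM : ι → A) (t : ι → ℝ)
    (L : List ι) : A :=
  ((L.insertionSort (fun i j => t j ≤ t i)).map (psi psiP psiM)).prod

/-- Given central part-commutators, the contraction `D(i,j)` is central (a c-number). -/
theorem D2_mem_center {ι A : Type*} [Ring A] (psiP psiM : ι → A) (t : ι → ℝ)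
    (hpp : ∀ i j : ι, psiP i * psiP j - psiP j * psiP i ∈ Set.center A)
    (hpm : ∀ i j : ι, psiP i * psiM j - psiM j * psiP i ∈ Set.center A)
    (hmm : ∀ i j : ι, psiM i * psiM j - psiM j * psiM i ∈ Set.center A)
    (i j : ι) : D2 psiP psiM t i j ∈ Set.center A := by
  unfold D2 T2 N2 psi
  split
  · have h :
        (psiP i + psiM i) * (psiP j + psiM j) -
            (psiP i * psiP j + psiM i * psiP j + psiM j * psiP i + psiM i * psiM j) =
          psiP i * psiM j - psiM j * psiP i := by noncomm_ring
    rw [h]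
    exact hpm i j
  · have h :
        (psiP j + psiM j) * (psiP i + psiM i) -
            (psiP i * psiP j + psiM i * psiP j + psiM j * psiP i + psiM i * psiM j) =
          (psiP j * psiP i - psiP i * psiP j) + (psiP j * psiM i - psiM i * psiP j) +
            (psiM j * psiM i - psiM i * psiM j) := by noncomm_ring
    rw [h]
    exact Set.add_mem_center (Set.add_mem_center (hpp j i) (hpm j i)) (hmm j i)

/-- The contraction attached to a two-element set of indices `p = {i, j}` with `i < j`:
`D(i,j)`; by convention `1` if `p` is not a doubleton. -/
noncomputable def Dpair {k : ℕ} {A : Type*} [Ring A] (psiP psiM : Fin k → A)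
    (t : Fin k → ℝ) (p : Finset (Fin k)) : A :=
  match p.sort (· ≤ ·) with
  | [i, j] => D2 psiP psiM t i j
  | _ => 1

theorem Dpair_mem_center {k : ℕ} {A : Type*} [Ring A] (psiP psiM : Fin k → A)
    (t : Fin k → ℝ)
    (hpp : ∀ i j, psiP i * psiP j - psiP j * psiP i ∈ Set.center A)
    (hpm : ∀ i j, psiP i * psiM j - psiM j * psiP i ∈ Set.center A)
    (hmm : ∀ i j, psiM i * psiM j - psiM j * psiM i ∈ Set.center A)
    (p : Finset (Fin k)) : Dpair psiP psiM t p ∈ Set.center A := by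
  unfold Dpair
  rcases hl : p.sort (· ≤ ·) with _ | ⟨i, _ | ⟨j, _ | _⟩⟩ <;>
    first
      | exact Set.one_mem_center
      | exact D2_mem_center psiP psiM t hpp hpm hmm i j

open Classical in
/-- The collection of all partial pairings of `{1,…,2n}`: sets `P` (possibly empty) of
pairwise disjoint 2-element subsets. -/
noncomputable def pairings (k : ℕ) : Finset (Finset (Finset (Fin k))) :=
  Finset.univ.filter fun P =>
    (∀ p ∈ P, p.card = 2) ∧ (P : Set (Finset (Fin k))).PairwiseDisjoint id

section OrderedProducts

variable {α A : Type*} [LinearOrder α] [Ring A]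

/-- The product of the values of `f` over a finite set, in increasing order of the indices. -/
def ordProd (f : α → A) (U : Finset α) : A := ((U.sort (· ≤ ·)).map f).prod

theorem ordProd_insert_of_lt (f : α → A) {a : α} {U : Finset α} (h : ∀ x ∈ U, a < x) :
    ordProd f (insert a U) = f a * ordProd f U := by
  have ha : a ∉ U := fun ha => lt_irrefl a (h a ha)
  simp [ordProd, Finset.sort_insert (h₁ := fun b hb => (h b hb).le) (h₂ := ha)]

/-- Moving an element with central commutators through an ordered product. -/
theorem mul_ordProd_eq_ordProd_mul_add (f : α → A) (y : A)
    (hc : ∀ r, y * f r - f r * y ∈ Set.center A) (U : Finset α) :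
    y * ordProd f U =
      ordProd f U * y + ∑ r ∈ U, (y * f r - f r * y) * ordProd f (U.erase r) := by
  induction U using Finset.induction_on_min with
  | empty => simp [ordProd]
  | insert a U h ih =>
    have ha : a ∉ U := fun ha => lt_irrefl a (h a ha)
    have hsum : ∑ r ∈ U, (y * f r - f r * y) * ordProd f ((insert a U).erase r) =
        f a * ∑ r ∈ U, (y * f r - f r * y) * ordProd f (U.erase r) := by
      rw [Finset.mul_sum]
      refine Finset.sum_congr rfl fun r hr => ?_
      rw [Finset.erase_insert_of_ne (h r hr).ne,
        ordProd_insert_of_lt f fun x hx => h x (Finset.mem_of_mem_erase hx), ← mul_assoc,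
        ← mul_assoc, ((Set.mem_center_iff.mp (hc r)).comm (f a)).eq]
    rw [Finset.sum_insert ha, hsum, Finset.erase_insert ha, ordProd_insert_of_lt f h,
      eq_sub_of_add_eq' ih.symm]
    noncomm_ring

/-- Moving a factor standing on the left of an ordered product to its place. -/
theorem mul_ordProd_eq_ordProd_insert_add (f : α → A) (m : α)
    (hc : ∀ r, f m * f r - f r * f m ∈ Set.center A) (U : Finset α) (hm : m ∉ U) :
    f m * ordProd f U =
      ordProd f (insert m U) +
        ∑ r ∈ U, (if r < m then f m * f r - f r * f m else 0) * ordProd f (U.erase r) := by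
  induction U using Finset.induction_on_min with
  | empty => simp [ordProd]
  | insert a U h ih =>
    have ha : a ∉ U := fun ha => lt_irrefl a (h a ha)
    rw [Finset.mem_insert, not_or] at hm
    rcases lt_or_gt_of_ne hm.1 with hlt | hlt
    · rw [ordProd_insert_of_lt f (a := m), Finset.sum_eq_zero, add_zero]
      · intro r hr
        have : ¬ r < m := by
          rcases Finset.mem_insert.mp hr with rfl | hr
          · exact hlt.asymm
          · exact (hlt.trans (h r hr)).asymm
        simp [this]
      · intro x hx
        rcases Finset.mem_insert.mp hx with rfl | hx
        · exact hlt
        · exact hlt.trans (h x hx)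
    · have hsum : ∑ r ∈ U, (if r < m then f m * f r - f r * f m else 0) *
            ordProd f ((insert a U).erase r) =
          f a * ∑ r ∈ U, (if r < m then f m * f r - f r * f m else 0) *
            ordProd f (U.erase r) := by
        rw [Finset.mul_sum]
        refine Finset.sum_congr rfl fun r hr => ?_
        rw [Finset.erase_insert_of_ne (h r hr).ne,
          ordProd_insert_of_lt f fun x hx => h x (Finset.mem_of_mem_erase hx), ← mul_assoc,
          ← mul_assoc]
        split
        · rw [((Set.mem_center_iff.mp (hc r)).comm (f a)).eq]
        · simp
      have hins : ordProd f (insert m (insert a U)) = f a * ordProd f (insert m U) := by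
        rw [Finset.insert_comm, ordProd_insert_of_lt]
        intro x hx
        rcases Finset.mem_insert.mp hx with rfl | hx
        · exact hlt
        · exact h x hx
      rw [Finset.sum_insert ha, hsum, Finset.erase_insert ha, ordProd_insert_of_lt f h, hins,
        if_pos hlt, eq_sub_of_add_eq' (ih hm.2).symm]
      noncomm_ring

/-- The normal ordered product of the fields indexed by a finite set. -/
def normalProd (psiP psiM : α → A) (S : Finset α) : A :=
  ∑ U ∈ S.powerset, ordProd psiM U * ordProd psiP (S \ U)

theorem map_get_filter_finRange {L : List α} (hL : L.SortedLT) (S : Finset (Fin L.length)) :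
    ((List.finRange L.length).filter (fun j => decide (j ∈ S))).map L.get =
      (S.map ⟨L.get, hL.strictMono_get.injective⟩).sort (· ≤ ·) := by
  refine List.SortedLT.eq_of_mem_iff ?_ (Finset.sortedLT_sort _) fun x => by simp
  refine List.Pairwise.sortedLT (List.Pairwise.map _ (R := (· < ·)) ?_ ?_)
  · exact fun _ _ h => hL.strictMono_get h
  · exact (List.pairwise_lt_finRange _).filter _

theorem Nord_sort (psiP psiM : α → A) (S : Finset α) :
    Nord psiP psiM (S.sort (· ≤ ·)) = normalProd psiP psiM S := by
  set L := S.sort (· ≤ ·) with hLdef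
  have hL : L.SortedLT := Finset.sortedLT_sort S
  let e : Fin L.length ↪ α := ⟨L.get, hL.strictMono_get.injective⟩
  have hS : Finset.univ.map e = S := by
    ext x
    rw [← Finset.mem_sort (s := S) (· ≤ ·), ← hLdef, List.mem_iff_get]
    simp [e]
  have hpow : S.powerset = (Finset.univ : Finset (Finset (Fin L.length))).map
      (Finset.mapEmbedding e).toEmbedding := by
    ext U
    simp only [Finset.mem_powerset, Finset.mem_map, Finset.mem_univ, true_and]
    constructor
    · intro hU
      rw [← hS, Finset.subset_map_iff] at hU
      obtain ⟨V, -, rfl⟩ := hU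
      exact ⟨V, rfl⟩
    · rintro ⟨V, rfl⟩
      rw [← hS]
      exact Finset.map_subset_map.mpr (Finset.subset_univ V)
  rw [normalProd, hpow, Finset.sum_map]
  refine Finset.sum_congr rfl fun V _ => ?_
  have hcompl : S \ V.map e = Vᶜ.map e := by
    rw [Finset.compl_eq_univ_sdiff, Finset.map_sdiff, hS]
  have h1 := map_get_filter_finRange hL V
  have h2 := map_get_filter_finRange hL Vᶜ
  simp only [Finset.mem_compl] at h2
  change _ = ordProd psiM (V.map e) * ordProd psiP (S \ V.map e)
  rw [hcompl, ordProd, ordProd, ← h1, ← h2, List.map_map, List.map_map]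
  rfl

theorem sum_powerset_sum_mem (S : Finset α) (F : α → Finset α → Finset α → A) :
    ∑ U ∈ S.powerset, ∑ r ∈ U, F r (U.erase r) (S \ U) =
      ∑ r ∈ S, ∑ U ∈ (S.erase r).powerset, F r U (S.erase r \ U) := by
  rw [Finset.sum_sigma', Finset.sum_sigma']
  refine Finset.sum_bij' (fun x _ => ⟨x.2, x.1.erase x.2⟩) (fun x _ => ⟨insert x.1 x.2, x.1⟩)
    ?_ ?_ ?_ ?_ ?_
  · rintro ⟨U, r⟩ h
    simp only [Finset.mem_sigma, Finset.mem_powerset] at h ⊢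
    exact ⟨h.1 h.2, Finset.erase_subset_erase r h.1⟩
  · rintro ⟨r, U⟩ h
    simp only [Finset.mem_sigma, Finset.mem_powerset] at h ⊢
    exact ⟨Finset.insert_subset h.1 (h.2.trans (Finset.erase_subset _ _)),
      Finset.mem_insert_self _ _⟩
  · rintro ⟨U, r⟩ h
    simp only [Finset.mem_sigma, Finset.mem_powerset] at h
    simp [Finset.insert_erase h.2]
  · rintro ⟨r, U⟩ h
    simp only [Finset.mem_sigma, Finset.mem_powerset] at h
    have : r ∉ U := fun hr => Finset.notMem_erase r S (h.2 hr)
    simp [Finset.erase_insert this]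
  · rintro ⟨U, r⟩ h
    simp only [Finset.mem_sigma, Finset.mem_powerset] at h
    have : S.erase r \ U.erase r = S \ U := by
      ext x
      simp only [Finset.mem_sdiff, Finset.mem_erase]
      grind
    simp [this]

theorem sum_powerset_sum_notMem (S : Finset α) (F : α → Finset α → Finset α → A) :
    ∑ U ∈ S.powerset, ∑ r ∈ S \ U, F r U ((S \ U).erase r) =
      ∑ r ∈ S, ∑ U ∈ (S.erase r).powerset, F r U (S.erase r \ U) := by
  rw [Finset.sum_comm' (t' := S) (s' := fun r => (S.erase r).powerset)]
  · refine Finset.sum_congr rfl fun r _ => Finset.sum_congr rfl fun U _ => ?_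
    rw [Finset.erase_sdiff_comm]
  · intro U r
    simp only [Finset.mem_powerset, Finset.mem_sdiff, Finset.subset_erase]
    tauto

theorem normalProd_insert (psiP psiM : α → A) {m : α} {S : Finset α} (hm : m ∉ S) :
    normalProd psiP psiM (insert m S) =
      ∑ U ∈ S.powerset, (ordProd psiM (insert m U) * ordProd psiP (S \ U) +
        ordProd psiM U * ordProd psiP (insert m (S \ U))) := by
  rw [normalProd, Finset.sum_powerset_insert hm, add_comm, ← Finset.sum_add_distrib]
  refine Finset.sum_congr rfl fun U hU => ?_
  have hmU : m ∉ U := fun h => hm (Finset.mem_powerset.mp hU h)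
  rw [Finset.insert_sdiff_of_notMem _ hmU, Finset.insert_sdiff_insert,
    Finset.sdiff_insert_of_notMem hm]

/-- Multiplying a normal ordered product on the left by one more field. -/
theorem psi_mul_normalProd (psiP psiM : α → A)
    (hpp : ∀ i j, psiP i * psiP j - psiP j * psiP i ∈ Set.center A)
    (hpm : ∀ i j, psiP i * psiM j - psiM j * psiP i ∈ Set.center A)
    (hmm : ∀ i j, psiM i * psiM j - psiM j * psiM i ∈ Set.center A)
    {m : α} {S : Finset α} (hm : m ∉ S) :
    psi psiP psiM m * normalProd psiP psiM S =
      normalProd psiP psiM (insert m S) +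
        ∑ r ∈ S, ((psiP m * psiM r - psiM r * psiP m) +
          (if r < m then psiM m * psiM r - psiM r * psiM m else 0) +
          (if r < m then psiP m * psiP r - psiP r * psiP m else 0)) *
            normalProd psiP psiM (S.erase r) := by
  have key : ∀ U ∈ S.powerset,
      psi psiP psiM m * (ordProd psiM U * ordProd psiP (S \ U)) =
        (ordProd psiM (insert m U) * ordProd psiP (S \ U) +
          ordProd psiM U * ordProd psiP (insert m (S \ U))) +
        (∑ r ∈ U, ((psiP m * psiM r - psiM r * psiP m) +
            (if r < m then psiM m * psiM r - psiM r * psiM m else 0)) *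
              (ordProd psiM (U.erase r) * ordProd psiP (S \ U)) +
        ∑ r ∈ S \ U, (if r < m then psiP m * psiP r - psiP r * psiP m else 0) *
              (ordProd psiM U * ordProd psiP ((S \ U).erase r))) := by
    intro U hU
    have hmU : m ∉ U := fun h => hm (Finset.mem_powerset.mp hU h)
    have hmS : m ∉ S \ U := fun h => hm (Finset.mem_sdiff.mp h).1
    have hlast : ∑ r ∈ S \ U, (if r < m then psiP m * psiP r - psiP r * psiP m else 0) *
        (ordProd psiM U * ordProd psiP ((S \ U).erase r)) =
        ordProd psiM U * ∑ r ∈ S \ U, (if r < m then psiP m * psiP r - psiP r * psiP m else 0) *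
          ordProd psiP ((S \ U).erase r) := by
      rw [Finset.mul_sum]
      refine Finset.sum_congr rfl fun r _ => ?_
      rw [← mul_assoc, ← mul_assoc]
      split
      · rw [((Set.mem_center_iff.mp (hpp m r)).comm _).eq]
      · simp
    simp only [add_mul, Finset.sum_add_distrib, hlast]
    simp only [← mul_assoc, ← Finset.sum_mul]
    rw [psi, add_mul, mul_ordProd_eq_ordProd_mul_add psiM (psiP m) (hpm m) U,
      mul_ordProd_eq_ordProd_insert_add psiM m (hmm m) U hmU, add_mul, add_mul, add_mul,
      mul_assoc (ordProd psiM U) (psiP m),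
      mul_ordProd_eq_ordProd_insert_add psiP m (hpp m) (S \ U) hmS, mul_add]
    abel
  rw [normalProd, Finset.mul_sum, Finset.sum_congr rfl key, Finset.sum_add_distrib,
    ← normalProd_insert psiP psiM hm, Finset.sum_add_distrib,
    sum_powerset_sum_mem S fun r U V => ((psiP m * psiM r - psiM r * psiP m) +
      (if r < m then psiM m * psiM r - psiM r * psiM m else 0)) *
        (ordProd psiM U * ordProd psiP V),
    sum_powerset_sum_notMem S fun r U V =>
      (if r < m then psiP m * psiP r - psiP r * psiP m else 0) *
        (ordProd psiM U * ordProd psiP V), ← Finset.sum_add_distrib]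
  simp only [← Finset.mul_sum, ← add_mul, normalProd]

end OrderedProducts

section Wick

variable {k : ℕ} {A : Type*} [Ring A]

/-- The contraction of the field of latest time with an earlier one. -/
theorem Dpair_of_lt (psiP psiM : Fin k → A) (t : Fin k → ℝ) {m r : Fin k} (h : t r < t m) :
    Dpair psiP psiM t {m, r} = (psiP m * psiM r - psiM r * psiP m) +
      (if r < m then psiM m * psiM r - psiM r * psiM m else 0) +
      (if r < m then psiP m * psiP r - psiP r * psiP m else 0) := by
  have hne : m ≠ r := by rintro rfl; exact lt_irrefl _ h
  rcases lt_or_gt_of_ne hne with hlt | hlt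
  · have hs : ({m, r} : Finset (Fin k)).sort (· ≤ ·) = [m, r] := by
      rw [Finset.sort_insert] <;> simp [hlt.le, hne]
    simp only [Dpair, hs, D2, T2, N2, psi, if_pos h, if_neg hlt.asymm, gt_iff_lt]
    noncomm_ring
  · have hs : ({m, r} : Finset (Fin k)).sort (· ≤ ·) = [r, m] := by
      rw [Finset.pair_comm, Finset.sort_insert] <;> simp [hlt.le, hne.symm]
    simp only [Dpair, hs, D2, T2, N2, psi, if_neg h.asymm, if_pos hlt, gt_iff_lt]
    noncomm_ring

theorem Tlist_sort_insert (psiP psiM : Fin k → A) (t : Fin k → ℝ) (ht : Function.Injective t)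
    {m : Fin k} {S : Finset (Fin k)} (hm : m ∉ S) (h : ∀ r ∈ S, t r ≤ t m) :
    Tlist psiP psiM t ((insert m S).sort (· ≤ ·)) =
      psi psiP psiM m * Tlist psiP psiM t (S.sort (· ≤ ·)) := by
  let R : Fin k → Fin k → Prop := fun i j => t j ≤ t i
  have : Std.Total R := ⟨fun i j => le_total _ _⟩
  have : IsTrans (Fin k) R := ⟨fun i j l hij hjl => le_trans hjl hij⟩
  have : Std.Antisymm R := ⟨fun i j hij hji => ht (le_antisymm hji hij)⟩
  have hl : ((insert m S).sort (· ≤ ·)).insertionSort R =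
      m :: (S.sort (· ≤ ·)).insertionSort R := by
    refine List.Perm.eq_of_pairwise' (r := R) (List.pairwise_insertionSort R _) ?_ ?_
    · refine List.Pairwise.cons (fun b hb => ?_) (List.pairwise_insertionSort R _)
      exact h b (by simpa using hb)
    · refine (List.perm_insertionSort R _).trans (List.Perm.trans ?_
        ((List.perm_insertionSort R _).symm.cons m))
      rw [List.perm_ext_iff_of_nodup (Finset.sort_nodup _ _)]
      · simp
      · simp [hm]
  have hl' := congrArg (fun l => (l.map (psi psiP psiM)).prod) hl
  simpa [Tlist, R] using hl'

theorem mem_pairings {P : Finset (Finset (Fin k))} :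
    P ∈ pairings k ↔
      (∀ p ∈ P, p.card = 2) ∧ ∀ p ∈ P, ∀ q ∈ P, p ≠ q → Disjoint p q := by
  simp [pairings, Set.PairwiseDisjoint, Set.Pairwise, Function.onFun]

/-- The partial pairings of a set `S` of indices. -/
noncomputable def pairingsOn (S : Finset (Fin k)) : Finset (Finset (Finset (Fin k))) :=
  (pairings k).filter fun P => P.sup id ⊆ S

theorem mem_pairingsOn {S : Finset (Fin k)} {P : Finset (Finset (Fin k))} :
    P ∈ pairingsOn S ↔ (∀ p ∈ P, p.card = 2) ∧ (∀ p ∈ P, ∀ q ∈ P, p ≠ q → Disjoint p q) ∧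
      ∀ p ∈ P, p ⊆ S := by
  rw [pairingsOn, Finset.mem_filter, mem_pairings, and_assoc, Finset.sup_le_iff]
  simp

theorem pairingsOn_empty : pairingsOn (∅ : Finset (Fin k)) = {∅} := by
  ext P
  rw [mem_pairingsOn, Finset.mem_singleton]
  constructor
  · rintro ⟨h2, -, hs⟩
    refine Finset.eq_empty_of_forall_notMem fun p hp => ?_
    have := h2 p hp
    rw [Finset.subset_empty.mp (hs p hp)] at this
    simp at this
  · rintro rfl
    simp

/-- In a partial pairing of `insert m S`, the index `m` is either unpaired or paired with
an element of `S`. -/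
theorem sum_pairingsOn_insert {m : Fin k} {S : Finset (Fin k)} (hm : m ∉ S)
    (F : Finset (Finset (Fin k)) → A) :
    ∑ P ∈ pairingsOn (insert m S), F P =
      ∑ P ∈ pairingsOn S, (F P + ∑ r ∈ S \ P.sup id, F (insert {m, r} P)) := by
  have hsub : pairingsOn S ⊆ pairingsOn (insert m S) := by
    intro P hP
    rw [mem_pairingsOn] at hP ⊢
    exact ⟨hP.1, hP.2.1, fun p hp => (hP.2.2 p hp).trans (Finset.subset_insert _ _)⟩
  rw [← Finset.sum_sdiff hsub, Finset.sum_add_distrib, add_comm, Finset.sum_sigma']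
  congr 1
  symm
  have hmP : ∀ P ∈ pairingsOn S, ∀ p ∈ P, m ∉ p := fun P hP p hp h =>
    hm ((mem_pairingsOn.mp hP).2.2 p hp h)
  have hsup : ∀ (P : Finset (Finset (Fin k))) (r : Fin k),
      r ∉ P.sup id ↔ ∀ p ∈ P, r ∉ p := by
    intro P r
    simp [Finset.mem_sup]
  refine Finset.sum_bij (fun x _ => insert {m, x.2} x.1) ?_ ?_ ?_ (fun _ _ => rfl)
  · rintro ⟨P, r⟩ h
    simp only [Finset.mem_sigma, Finset.mem_sdiff, hsup] at h
    obtain ⟨hP, hrS, hr⟩ := h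
    have hmp := hmP P hP
    have hne : m ≠ r := by rintro rfl; exact hm hrS
    have hdisj : ∀ p ∈ P, Disjoint {m, r} p := fun p hp => by
      simp [Finset.disjoint_insert_left, hmp p hp, hr p hp]
    rw [Finset.mem_sdiff]
    constructor
    · rw [mem_pairingsOn] at hP ⊢
      simp only [Finset.forall_mem_insert]
      refine ⟨⟨Finset.card_pair hne, hP.1⟩, ⟨⟨by simp, fun q hq _ => hdisj q hq⟩,
        fun p hp => ⟨fun _ => (hdisj p hp).symm, hP.2.1 p hp⟩⟩, ?_,
        fun p hp => (hP.2.2 p hp).trans (Finset.subset_insert _ _)⟩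
      intro x hx
      simp only [Finset.mem_insert, Finset.mem_singleton] at hx ⊢
      rcases hx with rfl | rfl
      · exact Or.inl rfl
      · exact Or.inr hrS
    · intro hQ
      exact hmP _ hQ {m, r} (Finset.mem_insert_self _ _) (by simp)
  · rintro ⟨P, r⟩ h ⟨P', r'⟩ h' heq
    simp only [Finset.mem_sigma, Finset.mem_sdiff, hsup] at h h' heq
    have hmp := hmP P h.1
    have hmp' := hmP P' h'.1
    have hne : m ≠ r := by rintro rfl; exact hm h.2.1
    have h1 : ({m, r} : Finset (Fin k)) = {m, r'} := by
      have : ({m, r} : Finset (Fin k)) ∈ insert {m, r'} P' := heq ▸ Finset.mem_insert_self _ _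
      rcases Finset.mem_insert.mp this with h | h
      · exact h
      · exact absurd (by simp) (hmp' _ h)
    have h2 : r = r' := by
      have : r ∈ ({m, r'} : Finset (Fin k)) := h1 ▸ (by simp)
      simpa [hne.symm] using this
    subst h2
    have h3 : P = P' := by
      rw [← Finset.erase_insert (fun h => hmp _ h (by simp) : {m, r} ∉ P), heq,
        Finset.erase_insert (fun h => hmp' _ h (by simp) : {m, r} ∉ P')]
    rw [h3]
  · intro Q hQ
    rw [Finset.mem_sdiff] at hQ
    obtain ⟨hQ, hQS⟩ := hQ
    rw [mem_pairingsOn] at hQ hQS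
    obtain ⟨h2, hd, hs⟩ := hQ
    obtain ⟨q, hq, hmq⟩ : ∃ q ∈ Q, m ∈ q := by
      by_contra! hno
      refine hQS ⟨h2, hd, fun p hp x hx => ?_⟩
      rcases Finset.mem_insert.mp (hs p hp hx) with rfl | h
      · exact absurd hx (hno p hp)
      · exact h
    obtain ⟨r, hrm, rfl⟩ : ∃ r, r ≠ m ∧ q = {m, r} := by
      have : (q.erase m).card = 1 := by rw [Finset.card_erase_of_mem hmq, h2 q hq]
      obtain ⟨r, hr⟩ := Finset.card_eq_one.mp this
      have hr' : r ∈ q.erase m := by simp [hr]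
      exact ⟨r, Finset.ne_of_mem_erase hr', by rw [← hr, Finset.insert_erase hmq]⟩
    have hdq : ∀ p ∈ Q.erase {m, r}, m ∉ p ∧ r ∉ p := by
      intro p hp
      have := hd _ hq p (Finset.mem_of_mem_erase hp) (Finset.ne_of_mem_erase hp).symm
      simpa [Finset.disjoint_insert_left] using this
    refine ⟨⟨Q.erase {m, r}, r⟩, ?_, Finset.insert_erase hq⟩
    simp only [Finset.mem_sigma, Finset.mem_sdiff, hsup, mem_pairingsOn]
    refine ⟨⟨fun p hp => h2 p (Finset.mem_of_mem_erase hp), fun p hp q hq =>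
      hd p (Finset.mem_of_mem_erase hp) q (Finset.mem_of_mem_erase hq), fun p hp x hx => ?_⟩,
      ?_, fun p hp => (hdq p hp).2⟩
    · rcases Finset.mem_insert.mp (hs p (Finset.mem_of_mem_erase hp) hx) with rfl | h
      · exact absurd hx (hdq p hp).1
      · exact h
    · have := hs _ hq (show r ∈ ({m, r} : Finset (Fin k)) by simp)
      simpa [hrm] using this

/-- **Wick's theorem** for the fields indexed by an arbitrary finite set. The contractions are
given as values in the center. -/
theorem Tlist_sort_eq_sum_pairingsOn (psiP psiM : Fin k → A) (t : Fin k → ℝ)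
    (ht : Function.Injective t)
    (hpp : ∀ i j, psiP i * psiP j - psiP j * psiP i ∈ Set.center A)
    (hpm : ∀ i j, psiP i * psiM j - psiM j * psiP i ∈ Set.center A)
    (hmm : ∀ i j, psiM i * psiM j - psiM j * psiM i ∈ Set.center A)
    (d : Finset (Fin k) → Subring.center A) (hd : ∀ p, (d p : A) = Dpair psiP psiM t p)
    (S : Finset (Fin k)) :
    Tlist psiP psiM t (S.sort (· ≤ ·)) =
      ∑ P ∈ pairingsOn S, ((∏ p ∈ P, d p : Subring.center A) : A) *
        normalProd psiP psiM (S \ P.sup id) := by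
  induction S using Finset.induction_on_max_value t with
  | empty => simp [pairingsOn_empty, Tlist, normalProd, ordProd]
  | insert m S hm h ih =>
    rw [Tlist_sort_insert psiP psiM t ht hm h, ih, sum_pairingsOn_insert hm, Finset.mul_sum]
    refine Finset.sum_congr rfl fun P hP => ?_
    have hmP : ∀ p ∈ P, m ∉ p := fun p hp hmp => hm ((mem_pairingsOn.mp hP).2.2 p hp hmp)
    have hmsup : m ∉ P.sup id := by simpa [Finset.mem_sup] using hmP
    have hmS : m ∉ S \ P.sup id := fun h => hm (Finset.mem_sdiff.mp h).1
    rw [← mul_assoc,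
      ← (Subring.mem_center_iff.mp (∏ p ∈ P, d p : Subring.center A).2 (psi psiP psiM m)).symm,
      mul_assoc, psi_mul_normalProd psiP psiM hpp hpm hmm hmS, mul_add, Finset.mul_sum,
      Finset.insert_sdiff_of_notMem _ hmsup]
    congr 1
    refine Finset.sum_congr rfl fun r hr => ?_
    have hrS := (Finset.mem_sdiff.mp hr).1
    have hne : r ≠ m := by rintro rfl; exact hm hrS
    have hlt : t r < t m := lt_of_le_of_ne (h r hrS) (ht.ne hne)
    have hnot : ({m, r} : Finset (Fin k)) ∉ P := fun h => hmP _ h (by simp)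
    have hsd : insert m S \ (insert {m, r} P).sup id = (S \ P.sup id).erase r := by
      rw [Finset.sup_insert]
      ext x
      simp only [id_eq, Finset.sup_eq_union, Finset.mem_sdiff, Finset.mem_insert,
        Finset.mem_union, Finset.mem_singleton, Finset.mem_erase]
      grind
    rw [← Dpair_of_lt psiP psiM t hlt, ← hd, Finset.prod_insert hnot, hsd,
      mul_comm (d {m, r}), Subring.coe_mul, mul_assoc]

end Wick

open Classical in
/-- **Wick's theorem for non-symmetric normal ordered products and contractions.**
If every part-commutator is central (the contraction is a c-number) and the times are
pairwise distinct, then the time-ordered product of all `2n` fields equals the usual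
Wick sum over all partial pairings `P`, each contributing the (central, hence
order-immaterial) product of the contractions `D(i,j)` (`i < j`) over the pairs of `P`
times the normal ordered product of the remaining indices in increasing order. -/
theorem stmt_11 {A : Type*} [Ring A] (n : ℕ)
    (psiP psiM : Fin (2 * n) → A) (t : Fin (2 * n) → ℝ) (ht : Function.Injective t)
    (hpp : ∀ i j : Fin (2 * n), psiP i * psiP j - psiP j * psiP i ∈ Set.center A)
    (hpm : ∀ i j : Fin (2 * n), psiP i * psiM j - psiM j * psiP i ∈ Set.center A)
    (hmp : ∀ i j : Fin (2 * n), psiM i * psiP j - psiP j * psiM i ∈ Set.center A)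
    (hmm : ∀ i j : Fin (2 * n), psiM i * psiM j - psiM j * psiM i ∈ Set.center A) :
    Tlist psiP psiM t (List.finRange (2 * n)) =
      ∑ P ∈ pairings (2 * n),
        P.noncommProd (Dpair psiP psiM t)
            (fun p _ q _ _ =>
              (Set.mem_center_iff.mp
                (Dpair_mem_center psiP psiM t hpp hpm hmm p)).comm _) *
          Nord psiP psiM ((Finset.univ \ P.sup id).sort (· ≤ ·)) := by
  have hpair : pairingsOn (Finset.univ : Finset (Fin (2 * n))) = pairings (2 * n) := by
    simp [pairingsOn]
  rw [← Fin.sort_univ, Tlist_sort_eq_sum_pairingsOn psiP psiM t ht hpp hpm hmm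
    (fun p => ⟨Dpair psiP psiM t p, Dpair_mem_center psiP psiM t hpp hpm hmm p⟩)
    (fun _ => rfl), hpair]
  refine Finset.sum_congr rfl fun P _ => ?_
  rw [Nord_sort, ← Finset.noncommProd_eq_prod]
  congr 1
  exact Finset.map_noncommProd P _ _ (Subring.center A).subtype
end

section
/- Let {ψᵢ = ψᵢ⁺ + ψᵢ⁻} be a family of fields in a ring A such that every commutator [ψᵢ^ε, ψⱼ^δ] with ε, δ ∈ {+,−} lies in the center of A, and such that the two-point symmetry condition [ψᵢ⁺, ψⱼ⁺] + [ψᵢ⁻, ψⱼ⁻] = 0 holds for all indices i, j. Then all higher normal ordered products are symmetric: for every finite sequence of indices (i₁,...,iₖ) and every permutation σ of {1,...,k}, N(i_{σ(1)},...,i_{σ(k)}) = N(i₁,...,iₖ). -/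
/-- The normal ordered product of a list of fields between `m` (to the left of the later `-` parts)
and `p` (to the left of the later `+` parts), defined by recursion on the list. -/
def nordAux {ι A : Type*} [Ring A] (psiP psiM : ι → A) : A → A → List ι → A
  | m, p, [] => m * p
  | m, p, i :: L => nordAux psiP psiM (m * psiM i) p L + nordAux psiP psiM m (p * psiP i) L

section nordAux

variable {ι A : Type*} [Ring A] (psiP psiM : ι → A)

lemma nordAux_sub_left (m m' p : A) (L : List ι) :
    nordAux psiP psiM (m - m') p L = nordAux psiP psiM m p L - nordAux psiP psiM m' p L := by
  induction L generalizing m m' p with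
  | nil => simp only [nordAux, sub_mul]
  | cons i L ih => simp only [nordAux, sub_mul, ih]; abel

lemma nordAux_add_right (m p p' : A) (L : List ι) :
    nordAux psiP psiM m (p + p') L = nordAux psiP psiM m p L + nordAux psiP psiM m p' L := by
  induction L generalizing m p p' with
  | nil => simp only [nordAux, mul_add]
  | cons i L ih => simp only [nordAux, add_mul, ih]; abel

lemma nordAux_sub_right (m p p' : A) (L : List ι) :
    nordAux psiP psiM m (p - p') L = nordAux psiP psiM m p L - nordAux psiP psiM m p' L := by
  rw [eq_sub_iff_add_eq, ← nordAux_add_right, sub_add_cancel]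

lemma nordAux_mul_center {c : A} (hc : c ∈ Set.center A) (m p : A) (L : List ι) :
    nordAux psiP psiM (m * c) p L = nordAux psiP psiM m (p * c) L := by
  have hcomm : ∀ a, c * a = a * c := fun a => (Set.mem_center_iff.1 hc).comm a
  induction L generalizing m p with
  | nil => simp only [nordAux, mul_assoc, hcomm]
  | cons i L ih =>
    simp only [nordAux]
    rw [mul_assoc m c, hcomm, ← mul_assoc, ih, ih, mul_assoc p c, hcomm, ← mul_assoc]

lemma nordAux_swap
    (hmm : ∀ i j : ι, psiM i * psiM j - psiM j * psiM i ∈ Set.center A)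
    (hsym : ∀ i j : ι,
      (psiP i * psiP j - psiP j * psiP i) + (psiM i * psiM j - psiM j * psiM i) = 0)
    (m p : A) (i j : ι) (L : List ι) :
    nordAux psiP psiM m p (i :: j :: L) = nordAux psiP psiM m p (j :: i :: L) := by
  have hM : nordAux psiP psiM (m * psiM i * psiM j) p L -
      nordAux psiP psiM (m * psiM j * psiM i) p L =
      nordAux psiP psiM m (p * (psiM i * psiM j - psiM j * psiM i)) L := by
    rw [← nordAux_sub_left, ← nordAux_mul_center psiP psiM (hmm i j), mul_sub, mul_assoc,
      mul_assoc]
  have hP : nordAux psiP psiM m (p * psiP i * psiP j) L -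
      nordAux psiP psiM m (p * psiP j * psiP i) L =
      nordAux psiP psiM m (p * (psiP i * psiP j - psiP j * psiP i)) L := by
    rw [← nordAux_sub_right, mul_sub, mul_assoc, mul_assoc]
  have hzero : nordAux psiP psiM m 0 L = 0 := by
    simpa using nordAux_sub_right psiP psiM m 0 0 L
  have hsum := congrArg₂ (· + ·) hP hM
  simp only [← nordAux_add_right, ← mul_add, hsym, mul_zero, hzero] at hsum
  simp only [nordAux]
  rw [← sub_eq_zero, ← hsum]
  abel

lemma nordAux_perm
    (hmm : ∀ i j : ι, psiM i * psiM j - psiM j * psiM i ∈ Set.center A)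
    (hsym : ∀ i j : ι,
      (psiP i * psiP j - psiP j * psiP i) + (psiM i * psiM j - psiM j * psiM i) = 0)
    {L L' : List ι} (h : L.Perm L') (m p : A) :
    nordAux psiP psiM m p L = nordAux psiP psiM m p L' := by
  induction h generalizing m p with
  | nil => rfl
  | cons i _ ih => simp only [nordAux, ih]
  | swap i j L => exact nordAux_swap psiP psiM hmm hsym m p j i L
  | trans _ _ ih₁ ih₂ => rw [ih₁, ih₂]

lemma sum_finset_fin_succ {M : Type*} [AddCommMonoid M] {n : ℕ}
    (f : Finset (Fin (n + 1)) → M) :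
    ∑ S, f S = ∑ S : Finset (Fin n), f (insert 0 (S.map (Fin.succEmb n))) +
      ∑ S : Finset (Fin n), f (S.map (Fin.succEmb n)) := by
  have hinj : Function.Injective (Finset.map (Fin.succEmb n)) := Finset.map_injective _
  have hpow : (Finset.univ.map (Fin.succEmb n)).powerset =
      Finset.univ.map ⟨Finset.map (Fin.succEmb n), hinj⟩ := by
    ext S
    simp only [Finset.mem_powerset, Finset.subset_map_iff, Finset.mem_map, Finset.mem_univ,
      Function.Embedding.coeFn_mk, true_and, Finset.subset_univ]
    simp only [eq_comm]
  have huniv : (Finset.univ : Finset (Fin (n + 1))) =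
      insert 0 (Finset.univ.map (Fin.succEmb n)) := by
    ext i
    cases i using Fin.cases <;> simp
  rw [← Finset.powerset_univ, huniv, Finset.sum_powerset_insert (by simp), hpow,
    Finset.sum_map, Finset.sum_map, add_comm]
  rfl

lemma sum_eq_nordAux (L : List ι) (m p : A) :
    ∑ S : Finset (Fin L.length),
      (m * (((List.finRange L.length).filter (fun j => decide (j ∈ S))).map
        (fun j => psiM (L.get j))).prod) *
      (p * (((List.finRange L.length).filter (fun j => decide (j ∉ S))).map
        (fun j => psiP (L.get j))).prod) = nordAux psiP psiM m p L := by
  induction L generalizing m p with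
  | nil => simp [nordAux]
  | cons i L ih =>
    simp only [nordAux, ← ih]
    refine (sum_finset_fin_succ (n := L.length) _).trans ?_
    congr 1 <;> refine Finset.sum_congr rfl fun S _ => ?_ <;>
      simp [List.finRange_succ, List.filter_map, Function.comp_def, mul_assoc]

lemma Nord_eq_nordAux (L : List ι) : Nord psiP psiM L = nordAux psiP psiM 1 1 L := by
  simp only [Nord, ← sum_eq_nordAux, one_mul]

end nordAux

/-- If all commutators `[ψᵢ^ε, ψⱼ^δ]` (`ε, δ ∈ {+,−}`) are central and the two-point
symmetry condition `[ψᵢ⁺, ψⱼ⁺] + [ψᵢ⁻, ψⱼ⁻] = 0` holds for all `i, j`, then all higher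
normal ordered products are symmetric under permutations of the fields. -/
theorem stmt_15 {ι A : Type*} [Ring A] (psiP psiM : ι → A)
    (hpp : ∀ i j : ι, psiP i * psiP j - psiP j * psiP i ∈ Set.center A)
    (hpm : ∀ i j : ι, psiP i * psiM j - psiM j * psiP i ∈ Set.center A)
    (hmp : ∀ i j : ι, psiM i * psiP j - psiP j * psiM i ∈ Set.center A)
    (hmm : ∀ i j : ι, psiM i * psiM j - psiM j * psiM i ∈ Set.center A)
    (hsym : ∀ i j : ι,
      (psiP i * psiP j - psiP j * psiP i) + (psiM i * psiM j - psiM j * psiM i) = 0)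
    (L : List ι) (σ : Equiv.Perm (Fin L.length)) :
    Nord psiP psiM (List.ofFn fun k => L.get (σ k)) = Nord psiP psiM L := by
  rw [Nord_eq_nordAux, Nord_eq_nordAux]
  refine nordAux_perm psiP psiM hmm hsym ?_ 1 1
  simpa only [List.ofFn_get, Function.comp_def] using Equiv.Perm.ofFn_comp_perm σ L.get
end
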